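/- arXiv:1801.07602 — 2 statements merged into one kernel-verified Lean document; each statement's English description precedes it below -/
import Mathlib

section
/- Let X = ⊔_{λ∈Λ}G_λ be a multiple conjugation biquandle and Y an X-set. Then the degenerate subgroups form a subcomplex of the prismatic chain complex: ∂_n(D_n(X)_Y) ⊆ D_{n−1}(X)_Y for all n. -/
structure IsMCB {Λ : Type u} (G : Λ → Type v) [∀ l, Group (G l)]
    (und ovr : (Σ l, G l) → (Σ l, G l) → (Σ l, G l)) : Prop where
  ex_uu : ∀ x y z, und (und x y) (und z y) = und (und x z) (ovr y z)
  ex_ou : ∀ x y z, ovr (und x y) (und z y) = und (ovr x z) (ovr y z)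
  ex_oo : ∀ x y z, ovr (ovr x y) (ovr z y) = ovr (ovr x z) (und y z)
  hom_und : ∀ (l : Λ) (x : Σ l, G l),
    ∃ (m : Λ) (f : G l →* G m), ∀ a : G l, und ⟨l, a⟩ x = ⟨m, f a⟩
  hom_ovr : ∀ (l : Λ) (x : Σ l, G l),
    ∃ (m : Λ) (f : G l →* G m), ∀ a : G l, ovr ⟨l, a⟩ x = ⟨m, f a⟩
  und_mul : ∀ (l : Λ) (a b : G l) (x : Σ l, G l),
    und x ⟨l, a * b⟩ = und (und x ⟨l, a⟩) (ovr ⟨l, b⟩ ⟨l, a⟩)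
  und_one : ∀ (l : Λ) (x : Σ l, G l), und x ⟨l, 1⟩ = x
  ovr_mul : ∀ (l : Λ) (a b : G l) (x : Σ l, G l),
    ovr x ⟨l, a * b⟩ = ovr (ovr x ⟨l, a⟩) (ovr ⟨l, b⟩ ⟨l, a⟩)
  ovr_one : ∀ (l : Λ) (x : Σ l, G l), ovr x ⟨l, 1⟩ = x
  conj : ∀ (l : Λ) (a b : G l), ovr ⟨l, a⁻¹ * b⟩ ⟨l, a⟩ = und ⟨l, b * a⁻¹⟩ ⟨l, a⟩

structure IsMCBAction {Λ : Type u} (G : Λ → Type v) [∀ l, Group (G l)]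
    (und ovr : (Σ l, G l) → (Σ l, G l) → (Σ l, G l))
    {Y : Type w} (act : Y → (Σ l, G l) → Y) : Prop where
  act_one : ∀ (y : Y) (l : Λ), act y ⟨l, 1⟩ = y
  act_mul : ∀ (y : Y) (l : Λ) (a b : G l),
    act y ⟨l, a * b⟩ = act (act y ⟨l, a⟩) (ovr ⟨l, b⟩ ⟨l, a⟩)
  act_ex : ∀ (y : Y) (a b : Σ l, G l),
    act (act y a) (ovr b a) = act (act y b) (und a b)

/-- A multiple conjugation biquandle: operations together with the axioms. -/
structure MCB (Λ : Type u) (G : Λ → Type v) [∀ l, Group (G l)] where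
  und : (Σ l, G l) → (Σ l, G l) → (Σ l, G l)
  ovr : (Σ l, G l) → (Σ l, G l) → (Σ l, G l)
  prop : IsMCB G und ovr

/-- A block `⟨x₁,…,x_m⟩`: a nonempty tuple of elements of a single group `G l`. -/
def MCBBlock (Λ : Type u) (G : Λ → Type v) : Type (max u v) :=
  Σ l : Λ, {xs : List (G l) // xs ≠ []}

variable {Λ : Type u} {G : Λ → Type v} [∀ l, Group (G l)]

open scoped Classical

/-- Number of entries of a block. -/
def MCBBlock.len (b : MCBBlock Λ G) : ℕ := b.2.1.length

/-- The first entry of a block, as an element of the disjoint union. -/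
def MCBBlock.head (b : MCBBlock Λ G) : Σ l, G l := ⟨b.1, b.2.1.head b.2.2⟩

/-- Entrywise application of `⊲ a` to a block. -/
noncomputable def MCB.blockUnd (M : MCB Λ G) (a : Σ l, G l) (b : MCBBlock Λ G) :
    MCBBlock Λ G :=
  ⟨(M.prop.hom_und b.1 a).choose,
   ⟨b.2.1.map (M.prop.hom_und b.1 a).choose_spec.choose,
    by simpa using b.2.2⟩⟩

/-- Entrywise application of `⊳ a` to a block. -/
noncomputable def MCB.blockOvr (M : MCB Λ G) (a : Σ l, G l) (b : MCBBlock Λ G) :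
    MCBBlock Λ G :=
  ⟨(M.prop.hom_ovr b.1 a).choose,
   ⟨b.2.1.map (M.prop.hom_ovr b.1 a).choose_spec.choose,
    by simpa using b.2.2⟩⟩

/-- The block `⟨x₁⁻¹x₂ ⊳ x₁, …, x₁⁻¹x_m ⊳ x₁⟩` appearing in `∂̃⟨x₁,…,x_m⟩`
(empty list of blocks if `m = 1`). -/
noncomputable def MCB.blockTilde (M : MCB Λ G) (b : MCBBlock Λ G) :
    List (MCBBlock Λ G) :=
  if h : b.2.1.tail = [] then []
  else
    [⟨(M.prop.hom_ovr b.1 ⟨b.1, b.2.1.head b.2.2⟩).choose,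
      ⟨b.2.1.tail.map
          (fun z => (M.prop.hom_ovr b.1 ⟨b.1, b.2.1.head b.2.2⟩).choose_spec.choose
            ((b.2.1.head b.2.2)⁻¹ * z)),
       fun hz => h (List.map_eq_nil_iff.mp hz)⟩⟩]

/-- Deleting the `j`-th entry (0-based) of a block; the block disappears if it
had a single entry. -/
noncomputable def MCBBlock.erase (b : MCBBlock Λ G) (j : ℕ) : List (MCBBlock Λ G) :=
  if h : b.2.1.eraseIdx j = [] then [] else [⟨b.1, ⟨b.2.1.eraseIdx j, h⟩⟩]

/-- The boundary of a generator `⟨y⟩⟨𝐱₁⟩⋯⟨𝐱_k⟩` of the prismatic chain complex. -/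
noncomputable def MCB.dGen (M : MCB Λ G) {Y : Type w} (act : Y → (Σ l, G l) → Y)
    (g : Y × List (MCBBlock Λ G)) :
    FreeAbelianGroup (Y × List (MCBBlock Λ G)) :=
  ∑ i : Fin g.2.length,
    ((-1 : ℤ) ^ ((g.2.take (i : ℕ)).map MCBBlock.len).sum) •
      (FreeAbelianGroup.of
          (act g.1 (g.2.get i).head,
           ((g.2.take (i : ℕ)).map (M.blockUnd (g.2.get i).head))
             ++ M.blockTilde (g.2.get i)
             ++ ((g.2.drop ((i : ℕ) + 1)).map (M.blockOvr (g.2.get i).head)))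
        + ∑ j : Fin (g.2.get i).len,
            ((-1 : ℤ) ^ ((j : ℕ) + 1)) •
              FreeAbelianGroup.of
                (g.1, g.2.take (i : ℕ) ++ (g.2.get i).erase (j : ℕ)
                  ++ g.2.drop ((i : ℕ) + 1)))

/-- The boundary operator of the prismatic chain complex `P_*(X)_Y`. -/
noncomputable def MCB.boundary (M : MCB Λ G) {Y : Type w} (act : Y → (Σ l, G l) → Y) :
    FreeAbelianGroup (Y × List (MCBBlock Λ G)) →+
      FreeAbelianGroup (Y × List (MCBBlock Λ G)) :=
  FreeAbelianGroup.lift (M.dGen act)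


/-- `padded a i` is `a_i` (1-based) for `1 ≤ i ≤ s`, and the identity otherwise. -/
def padded {l : Λ} {s : ℕ} (a : Fin s → G l) (i : ℕ) : G l :=
  if h : 0 < i ∧ i ≤ s then a ⟨i - 1, by omega⟩ else 1

/-- `⌊j;μ⌋ = #{k : μ(k) ≤ j}` (0-based `j`). -/
def flr {s n : ℕ} (μ : Fin s → Fin n) (j : ℕ) : ℕ :=
  (Finset.univ.filter (fun k : Fin s => ((μ k : ℕ) ≤ j))).card

/-- The entries `c_j = a_{⌊j;μ⌋} b_{j−⌊j;μ⌋}` of the `μ`-term of the shuffle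
`⟨⟨𝐚⟩⟨𝐛⟩⟩` (with 1-based `j` running through `1,…,s+t`). -/
def shuffleEntries {l : Λ} {s t : ℕ} (a : Fin s → G l) (b : Fin t → G l)
    (μ : Fin s → Fin (s + t)) : List (G l) :=
  List.ofFn (fun j : Fin (s + t) =>
    padded a (flr μ (j : ℕ)) * padded b ((j : ℕ) + 1 - flr μ (j : ℕ)))

/-- The generator `⟨y⟩⟨𝐱₁⟩⋯⟨xs⟩⋯⟨𝐱_k⟩` with the block `xs` inserted between the
blocks `pre` and `post` (zero if `xs` is empty). -/
noncomputable def mkGen {Y : Type w} (y : Y) (pre post : List (MCBBlock Λ G))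
    (l : Λ) (xs : List (G l)) : FreeAbelianGroup (Y × List (MCBBlock Λ G)) :=
  if h : xs = [] then 0 else FreeAbelianGroup.of (y, pre ++ ⟨l, ⟨xs, h⟩⟩ :: post)

/-- The chain `⟨y⟩⟨𝐱₁⟩⋯⟨⟨𝐚⟩⟨𝐛⟩⟩⋯⟨𝐱_k⟩`: the signed sum of shuffles of the
blocks `𝐚` and `𝐛`, in the context `pre`, `post`. -/
noncomputable def shuffleChain {Y : Type w} (y : Y) (pre post : List (MCBBlock Λ G))
    {l : Λ} {s t : ℕ} (a : Fin s → G l) (b : Fin t → G l) :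
    FreeAbelianGroup (Y × List (MCBBlock Λ G)) :=
  ∑ μ : Fin s → Fin (s + t),
    if StrictMono μ then
      ((-1 : ℤ) ^ (∑ k : Fin s, ((μ k : ℕ) - (k : ℕ)))) •
        mkGen y pre post l (shuffleEntries a b μ)
    else 0


/-- The set of generating elements
`⟨y⟩⟨𝐱₁⟩⋯⟨𝐚⟩⟨𝐛⟩⋯⟨𝐱_k⟩ − ⟨y⟩⟨𝐱₁⟩⋯⟨⟨𝐚⟩⟨𝐛⟩⟩⋯⟨𝐱_k⟩` of the degenerate
subcomplex `D_*(X)_Y`. -/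
def degenSet (Y : Type w) (Λ : Type u) (G : Λ → Type v) [∀ l, Group (G l)] :
    Set (FreeAbelianGroup (Y × List (MCBBlock Λ G))) :=
  { c | ∃ (y : Y) (pre post : List (MCBBlock Λ G)) (l : Λ) (s t : ℕ)
      (hs : 0 < s) (ht : 0 < t) (a : Fin s → G l) (b : Fin t → G l),
      c = FreeAbelianGroup.of
            (y, pre ++ ⟨l, ⟨List.ofFn a, by simp only [ne_eq, List.ofFn_eq_nil_iff]; omega⟩⟩
              :: ⟨l, ⟨List.ofFn b, by simp only [ne_eq, List.ofFn_eq_nil_iff]; omega⟩⟩ :: post)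
          - shuffleChain y pre post a b }

/-- The signed sum, over all lattice paths, of the values of `g` on the vertices `p * q` of a path
through the grid `A × B` that starts at `x * y`. -/
def gridShuffle {H : Type*} [Group H] {Q : Type*} [AddCommGroup Q] :
    (List H → Q) → H → H → List H → List H → Q
  | g, x, _, [], B => g (B.map (x * ·))
  | g, _, y, a :: A, [] => g ((a :: A).map (· * y))
  | g, x, y, a :: A, b :: B =>
      gridShuffle (fun X => g (a * y :: X)) a y A (b :: B)
        + (-1 : ℤ) ^ (A.length + 1) • gridShuffle (fun X => g (x * b :: X)) x b (a :: A) B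
  termination_by _ _ _ A B => A.length + B.length

/-- The alternating sum of the values of `g` on the lists obtained by deleting one entry. -/
def faceSum {H : Type*} {Q : Type*} [AddCommGroup Q] : (List H → Q) → List H → Q
  | _, [] => 0
  | g, x :: X => -g X - faceSum (fun Z => g (x :: Z)) X

/-- Induction principle for statements about `gridShuffle`. -/
theorem grid_induction {H Q : Type*}
    {motive : (List H → Q) → H → H → List H → List H → Prop}
    (nil_left : ∀ g x y B, motive g x y [] B)
    (nil_right : ∀ g x y A, motive g x y A [])
    (cons_cons : ∀ (g : List H → Q) (x y a b : H) (A B : List H),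
      (∀ g x y, motive g x y A (b :: B)) → (∀ g x y, motive g x y (a :: A) B) →
        motive g x y (a :: A) (b :: B))
    (g : List H → Q) (x y : H) (A B : List H) : motive g x y A B := by
  induction A generalizing g x y B with
  | nil => exact nil_left g x y B
  | cons a A ihA =>
    induction B generalizing g x y with
    | nil => exact nil_right g x y _
    | cons b B ihB => exact cons_cons g x y a b A B (fun g x y => ihA g x y _) ihB

section FaceSum

variable {H : Type*} {Q : Type*} [AddCommGroup Q]

theorem faceSum_add (g g' : List H → Q) (X : List H) :
    faceSum (fun Z => g Z + g' Z) X = faceSum g X + faceSum g' X := by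
  induction X generalizing g g' with
  | nil => simp [faceSum]
  | cons x X ih => simp only [faceSum, ih]; abel

theorem faceSum_sign (k : ℕ) (g : List H → Q) (X : List H) :
    faceSum (fun Z => (-1 : ℤ) ^ (Z.length + k) • g Z) X
      = -((-1 : ℤ) ^ (X.length + k) • faceSum g X) := by
  induction X generalizing g k with
  | nil => simp [faceSum]
  | cons x X ih =>
    simp only [faceSum, List.length_cons, add_right_comm _ 1 k, add_assoc _ k 1, ih]
    rw [← add_assoc, pow_succ]
    module

theorem faceSum_zsmul (c : ℤ) (g : List H → Q) (X : List H) :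
    faceSum (fun Z => c • g Z) X = c • faceSum g X := by
  induction X generalizing g with
  | nil => simp [faceSum]
  | cons x X ih => simp only [faceSum, ih]; module

theorem faceSum_eq_sum (g : List H → Q) (X : List H) :
    faceSum g X = ∑ j : Fin X.length, (-1 : ℤ) ^ ((j : ℕ) + 1) • g (X.eraseIdx j) := by
  induction X generalizing g with
  | nil => simp [faceSum]
  | cons x X ih =>
    simp only [faceSum, List.length_cons, Fin.sum_univ_succ, ih]
    simp [pow_succ, sub_eq_add_neg]

end FaceSum

section Shuffle

variable {H K : Type*} [Group H] [Group K] {Q : Type*} [AddCommGroup Q]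

@[simp]
theorem gridShuffle_nil_left (g : List H → Q) (x y : H) (B : List H) :
    gridShuffle g x y [] B = g (B.map (x * ·)) := by
  rw [gridShuffle]

@[simp]
theorem gridShuffle_nil_right (g : List H → Q) (x y : H) (A : List H) :
    gridShuffle g x y A [] = g (A.map (· * y)) := by
  cases A with
  | nil => rw [gridShuffle_nil_left]; rfl
  | cons a A => rw [gridShuffle]

theorem gridShuffle_cons_cons (g : List H → Q) (x y a b : H) (A B : List H) :
    gridShuffle g x y (a :: A) (b :: B) =
      gridShuffle (fun X => g (a * y :: X)) a y A (b :: B)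
        + (-1 : ℤ) ^ (A.length + 1) •
          gridShuffle (fun X => g (x * b :: X)) x b (a :: A) B := by
  rw [gridShuffle]

theorem gridShuffle_congr {g g' : List H → Q} (x y : H) {A B : List H}
    (h : ∀ X : List H, X.length = A.length + B.length → g X = g' X) :
    gridShuffle g x y A B = gridShuffle g' x y A B := by
  induction g, x, y, A, B using grid_induction generalizing g' with
  | nil_left => simp [h]
  | nil_right => simp [h]
  | cons_cons g x y a b A B ihA ihB =>
    rw [gridShuffle_cons_cons, gridShuffle_cons_cons,
      ihA _ _ _ fun X hX => h _ (by simp [hX]; omega),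
      ihB _ _ _ fun X hX => h _ (by simp [hX]; omega)]

theorem gridShuffle_add (g g' : List H → Q) (x y : H) (A B : List H) :
    gridShuffle (fun X => g X + g' X) x y A B
      = gridShuffle g x y A B + gridShuffle g' x y A B := by
  induction g, x, y, A, B using grid_induction generalizing g' with
  | nil_left => simp
  | nil_right => simp
  | cons_cons g x y a b A B ihA ihB =>
    simp only [gridShuffle_cons_cons, ihA, ihB, smul_add]
    abel

theorem map_gridShuffle {R : Type*} [AddCommGroup R] (φ : Q →+ R) (g : List H → Q) (x y : H)
    (A B : List H) :
    φ (gridShuffle g x y A B) = gridShuffle (fun X => φ (g X)) x y A B := by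
  induction g, x, y, A, B using grid_induction with
  | nil_left => simp
  | nil_right => simp
  | cons_cons g x y a b A B ihA ihB =>
    simp only [gridShuffle_cons_cons, map_add, map_zsmul, ihA, ihB]

theorem gridShuffle_zero (x y : H) (A B : List H) :
    gridShuffle (fun _ => (0 : Q)) x y A B = 0 :=
  (map_gridShuffle (0 : Q →+ Q) (fun _ => 0) x y A B).symm

theorem gridShuffle_zsmul (c : ℤ) (g : List H → Q) (x y : H) (A B : List H) :
    gridShuffle (fun X => c • g X) x y A B = c • gridShuffle g x y A B :=
  (map_gridShuffle (zsmulAddGroupHom c) g x y A B).symm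

theorem gridShuffle_neg (g : List H → Q) (x y : H) (A B : List H) :
    gridShuffle (fun X => -g X) x y A B = -gridShuffle g x y A B :=
  (map_gridShuffle (-AddMonoidHom.id Q) g x y A B).symm

theorem gridShuffle_map (u v h : H → K) (huv : ∀ p q, h (p * q) = u p * v q)
    (g : List K → Q) (x y : H) (A B : List H) :
    gridShuffle (fun X => g (X.map h)) x y A B
      = gridShuffle g (u x) (v y) (A.map u) (B.map v) := by
  suffices ∀ g' : List H → Q, ∀ g : List K → Q, g' = (fun X => g (X.map h)) →
      gridShuffle g' x y A B = gridShuffle g (u x) (v y) (A.map u) (B.map v) from this _ _ rfl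
  intro g'
  clear g
  induction g', x, y, A, B using grid_induction with
  | nil_left => rintro g rfl; simp [Function.comp_def, huv]
  | nil_right => rintro g rfl; simp [Function.comp_def, huv]
  | cons_cons g' x y a b A B ihA ihB =>
    rintro g rfl
    rw [gridShuffle_cons_cons, List.map_cons, List.map_cons, gridShuffle_cons_cons,
      ihA _ _ _ (fun X => g (u a * v y :: X)) (by simp [huv]),
      ihB _ _ _ (fun X => g (u x * v b :: X)) (by simp [huv])]
    simp

/-- The part of the shuffle sum that does not begin with a step in the second direction does not
depend on the first starting coordinate. -/
theorem gridShuffle_sub_left (g : List H → Q) (x x' y b : H) (A B : List H) :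
    gridShuffle g x y A (b :: B)
        - (-1 : ℤ) ^ A.length • gridShuffle (fun X => g (x * b :: X)) x b A B
      = gridShuffle g x' y A (b :: B)
        - (-1 : ℤ) ^ A.length • gridShuffle (fun X => g (x' * b :: X)) x' b A B := by
  cases A with
  | nil => simp
  | cons a A => simp [gridShuffle_cons_cons]

theorem gridShuffle_sub_right (g : List H → Q) (x y y' a : H) (A B : List H) :
    gridShuffle g x y (a :: A) B - gridShuffle (fun X => g (a * y :: X)) a y A B
      = gridShuffle g x y' (a :: A) B - gridShuffle (fun X => g (a * y' :: X)) a y' A B := by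
  cases B with
  | nil => simp
  | cons b B => simp [gridShuffle_cons_cons]

/-- Deleting vertices from shuffles is a graded derivation. -/
theorem gridShuffle_faceSum (g : List H → Q) (x y : H) (A B : List H) :
    gridShuffle (faceSum g) x y A B
      = faceSum (fun A' => gridShuffle g x y A' B) A
        + (-1 : ℤ) ^ A.length • faceSum (fun B' => gridShuffle g x y A B') B := by
  induction g, x, y, A, B using grid_induction with
  | nil_left g x y B =>
    simp only [gridShuffle_nil_left, faceSum, List.length_nil, pow_zero, one_smul, zero_add]
    induction B generalizing g with
    | nil => simp [faceSum]
    | cons b B ih => simp only [List.map_cons, faceSum, ih]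
  | nil_right g x y A =>
    simp only [gridShuffle_nil_right, faceSum, smul_zero, add_zero]
    induction A generalizing g with
    | nil => simp [faceSum]
    | cons a A ih => simp only [List.map_cons, faceSum, ih]
  | cons_cons g x y a b A B ihA ihB =>
    have hA := ihA (fun X => g (a * y :: X)) a y
    have hB := ihB (fun X => g (x * b :: X)) x b
    have h1 := gridShuffle_sub_left g x a y b A B
    have h2 := gridShuffle_sub_right g x y b a A B
    simp only [gridShuffle_cons_cons, faceSum, sub_eq_add_neg, gridShuffle_add, gridShuffle_neg,
      faceSum_add, faceSum_sign, faceSum_zsmul, List.length_cons] at hA hB h1 h2 ⊢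
    rw [hA, hB]
    rw [← sub_eq_add_neg, ← sub_eq_add_neg, sub_eq_iff_eq_add] at h1 h2
    rw [h1, h2]
    module

end Shuffle

section PathSum

variable {H : Type*} [Group H] {Q : Type*} [AddCommGroup Q]

/-- The signed sum over strictly increasing maps, written in terms of sequences of vertices whose
zeroth terms are the starting coordinates. -/
def pathSum (g : List H → Q) (α β : ℕ → H) (s n : ℕ) : Q :=
  ∑ μ : Fin s → Fin n,
    if StrictMono μ then
      ((-1 : ℤ) ^ (∑ k : Fin s, ((μ k : ℕ) - (k : ℕ)))) •
        g (List.ofFn fun j : Fin n => α (flr μ j) * β ((j : ℕ) + 1 - flr μ j))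
    else 0

theorem StrictMono.fin_le {s n : ℕ} {μ : Fin s → Fin n} (hμ : StrictMono μ) (k : Fin s) :
    (k : ℕ) ≤ μ k := by
  obtain ⟨k, hk⟩ := k
  induction k with
  | zero => exact Nat.zero_le _
  | succ k ih =>
    have h1 := ih (by omega)
    have h2 : μ ⟨k, by omega⟩ < μ ⟨k + 1, hk⟩ := hμ (Fin.mk_lt_mk.mpr k.lt_succ_self)
    exact lt_of_le_of_lt h1 h2

theorem flr_le_succ {s n : ℕ} {μ : Fin s → Fin n} (hμ : StrictMono μ) (j : ℕ) :
    flr μ j ≤ j + 1 := by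
  rw [flr, ← Finset.card_range (j + 1)]
  refine Finset.card_le_card_of_injOn (fun k => (k : ℕ)) (fun k hk => ?_)
    (fun k _ k' _ h => Fin.ext h)
  have := hμ.fin_le k
  simp only [Finset.coe_filter, Finset.mem_univ, true_and, Set.mem_ofPred_eq] at hk
  simp only [Finset.coe_range, Set.mem_Iio]
  omega

theorem flr_cons_zero {s n : ℕ} (μ : Fin s → Fin n) :
    flr (Fin.cons 0 (fun k => (μ k).succ) : Fin (s + 1) → Fin (n + 1)) 0 = 1 := by
  rw [flr, Finset.card_filter, Fin.sum_univ_succ]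
  simp

theorem flr_cons_succ {s n : ℕ} (μ : Fin s → Fin n) (j : ℕ) :
    flr (Fin.cons 0 (fun k => (μ k).succ) : Fin (s + 1) → Fin (n + 1)) (j + 1) = flr μ j + 1 := by
  rw [flr, flr, Finset.card_filter, Finset.card_filter, Fin.sum_univ_succ]
  simp [add_comm]

theorem flr_succ_zero {s n : ℕ} (μ : Fin s → Fin n) : flr (fun k => (μ k).succ) 0 = 0 := by
  simp [flr]

theorem flr_succ_succ {s n : ℕ} (μ : Fin s → Fin n) (j : ℕ) :
    flr (fun k => (μ k).succ) (j + 1) = flr μ j := by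
  simp [flr]

theorem strictMono_cons_zero {s n : ℕ} {μ : Fin s → Fin n} :
    StrictMono (Fin.cons 0 (fun k => (μ k).succ) : Fin (s + 1) → Fin (n + 1)) ↔ StrictMono μ := by
  constructor
  · intro h i j hij
    simpa using h (Fin.succ_lt_succ_iff.mpr hij)
  · intro h i j hij
    induction j using Fin.cases with
    | zero => exact absurd hij (Fin.not_lt_zero i)
    | succ j =>
      induction i using Fin.cases with
      | zero => simp
      | succ i => simpa using h (Fin.succ_lt_succ_iff.mp hij)

theorem pathSum_eq_zero (g : List H → Q) (α β : ℕ → H) {s n : ℕ} (h : n < s) :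
    pathSum g α β s n = 0 := by
  refine Finset.sum_eq_zero fun μ _ => if_neg fun hμ => ?_
  have := Fintype.card_le_of_injective μ hμ.injective
  simp at this
  omega

theorem pathSum_zero (g : List H → Q) (α β : ℕ → H) (n : ℕ) :
    pathSum g α β 0 n = g (List.ofFn fun j : Fin n => α 0 * β (j + 1)) := by
  simp [pathSum, Subsingleton.strictMono, flr]

theorem pathSum_succ_succ (g : List H → Q) (α β : ℕ → H) (s n : ℕ) :
    pathSum g α β (s + 1) (n + 1) =
      pathSum (fun X => g (α 1 * β 0 :: X)) (fun i => α (i + 1)) β s n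
        + (-1 : ℤ) ^ (s + 1) •
          pathSum (fun X => g (α 0 * β 1 :: X)) α (fun i => β (i + 1)) (s + 1) n := by
  simp only [pathSum]
  rw [← Finset.sum_filter, ← Finset.sum_filter_add_sum_filter_not _ (fun μ => μ 0 = 0),
    ← Finset.sum_filter, ← Finset.sum_filter, Finset.smul_sum]
  congr 1
  · symm
    refine Finset.sum_nbij (fun μ => Fin.cons 0 fun k => (μ k).succ) ?_ ?_ ?_ ?_
    · intro μ hμ
      simpa [strictMono_cons_zero] using hμ
    · intro μ _ ν _ h
      funext k
      simpa using congrFun h k.succ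
    · intro μ hμ
      simp only [Finset.coe_filter, Finset.mem_filter, Finset.mem_univ, true_and,
        Set.mem_ofPred_eq] at hμ
      have hne (k : Fin s) : μ k.succ ≠ 0 :=
        (lt_of_le_of_lt (Fin.zero_le (μ 0)) (hμ.1 (Fin.succ_pos k))).ne'
      have hcons : (Fin.cons 0 fun k => ((μ k.succ).pred (hne k)).succ) = μ := by
        funext k
        induction k using Fin.cases with
        | zero => simp [hμ.2]
        | succ k => simp
      refine ⟨fun k => (μ k.succ).pred (hne k), ?_, hcons⟩
      rw [Finset.mem_coe, Finset.mem_filter_univ, ← strictMono_cons_zero, hcons]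
      exact hμ.1
    · intro μ _
      rw [Fin.sum_univ_succ, List.ofFn_succ]
      simp [flr_cons_zero, flr_cons_succ]
  · symm
    refine Finset.sum_nbij (fun μ k => (μ k).succ) ?_ ?_ ?_ ?_
    · intro μ hμ
      have hμ' : StrictMono μ := by simpa using hμ
      simpa [Function.comp_def] using Fin.strictMono_succ.comp hμ'
    · intro μ _ ν _ h
      funext k
      simpa using congrFun h k
    · intro μ hμ
      simp only [Finset.coe_filter, Finset.mem_filter, Finset.mem_univ, true_and,
        Set.mem_ofPred_eq] at hμ
      have hne (k : Fin (s + 1)) : μ k ≠ 0 :=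
        (lt_of_lt_of_le (Fin.pos_of_ne_zero hμ.2) (hμ.1.monotone (Fin.zero_le k))).ne'
      refine ⟨fun k => (μ k).pred (hne k), ?_, by simp⟩
      rw [Finset.mem_coe, Finset.mem_filter_univ]
      exact fun i j hij => Fin.pred_lt_pred_iff.mpr (hμ.1 hij)
    · intro μ hμ
      have hμ' : StrictMono μ := by simpa using hμ
      have hsum : ∑ k, (((μ k).succ : ℕ) - (k : ℕ)) = (s + 1) + ∑ k, ((μ k : ℕ) - (k : ℕ)) := by
        calc _ = ∑ k, (1 + ((μ k : ℕ) - (k : ℕ))) :=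
              Finset.sum_congr rfl fun k _ => by
                have := hμ'.fin_le k
                simp only [Fin.val_succ]
                omega
          _ = _ := by simp [Finset.sum_add_distrib]
      have hsub (j : ℕ) : j + 1 + 1 - flr μ j = j + 1 - flr μ j + 1 :=
        Nat.sub_add_comm (flr_le_succ hμ' j)
      rw [hsum, List.ofFn_succ, smul_smul, ← pow_add]
      simp [flr_succ_zero, flr_succ_succ, hsub]

theorem pathSum_eq_gridShuffle (g : List H → Q) (α β : ℕ → H) (s t : ℕ) :
    pathSum g α β s (s + t) =
      gridShuffle g (α 0) (β 0) (List.ofFn fun i : Fin s => α (i + 1))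
        (List.ofFn fun i : Fin t => β (i + 1)) := by
  induction s generalizing g α β t with
  | zero =>
    rw [zero_add, pathSum_zero]
    simp [List.map_ofFn, Function.comp_def]
  | succ s ihs =>
    induction t generalizing g α β with
    | zero =>
      rw [pathSum_succ_succ, pathSum_eq_zero _ _ _ (Nat.lt_succ_self s)]
      have h0 := fun g α => ihs g α β 0
      rw [add_zero] at h0
      rw [h0]
      simp [List.ofFn_succ]
    | succ t iht =>
      rw [show s + 1 + (t + 1) = (s + (t + 1)) + 1 by omega, pathSum_succ_succ, ihs,
        show s + (t + 1) = s + 1 + t by omega, iht]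
      simp [List.ofFn_succ, gridShuffle_cons_cons]

end PathSum

theorem shuffleChain_eq_gridShuffle {Y : Type w} (y : Y) (pre post : List (MCBBlock Λ G))
    {l : Λ} {s t : ℕ} (a : Fin s → G l) (b : Fin t → G l) :
    shuffleChain y pre post a b
      = gridShuffle (mkGen y pre post l) 1 1 (List.ofFn a) (List.ofFn b) := by
  refine (pathSum_eq_gridShuffle (mkGen y pre post l) (padded a) (padded b) s t).trans ?_
  have hpad {r : ℕ} (c : Fin r → G l) : (fun i : Fin r => padded c (i + 1)) = c := by
    funext i
    simp [padded, Nat.succ_le_of_lt i.isLt]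
  rw [hpad, hpad]
  simp [padded]

/-- The block with entries `x :: X`. -/
def MCBBlock.cons (l : Λ) (x : G l) (X : List (G l)) : MCBBlock Λ G :=
  ⟨l, ⟨x :: X, List.cons_ne_nil x X⟩⟩

/-- The list consisting of one block, or of none if there are no entries. -/
def blk (l : Λ) (X : List (G l)) : List (MCBBlock Λ G) :=
  if h : X = [] then [] else [⟨l, ⟨X, h⟩⟩]

@[simp]
theorem blk_nil {Λ : Type u} {G : Λ → Type v} (l : Λ) : blk l ([] : List (G l)) = [] := dif_pos rfl

@[simp]
theorem blk_cons {Λ : Type u} {G : Λ → Type v} (l : Λ) (x : G l) (X : List (G l)) :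
    blk l (x :: X) = [MCBBlock.cons l x X] :=
  dif_neg (List.cons_ne_nil x X)

theorem sum_len_blk {Λ : Type u} {G : Λ → Type v} (l : Λ) (X : List (G l)) :
    ((blk l X).map MCBBlock.len).sum = X.length := by
  cases X with
  | nil => simp
  | cons x X => simp [show (MCBBlock.cons l x X).len = X.length + 1 from rfl]

theorem MCB.und_choose (M : MCB Λ G) (l : Λ) (x : Σ l, G l) (a : G l) :
    M.und ⟨l, a⟩ x
      = ⟨(M.prop.hom_und l x).choose, (M.prop.hom_und l x).choose_spec.choose a⟩ :=
  (M.prop.hom_und l x).choose_spec.choose_spec a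

theorem MCB.ovr_choose (M : MCB Λ G) (l : Λ) (x : Σ l, G l) (a : G l) :
    M.ovr ⟨l, a⟩ x
      = ⟨(M.prop.hom_ovr l x).choose, (M.prop.hom_ovr l x).choose_spec.choose a⟩ :=
  (M.prop.hom_ovr l x).choose_spec.choose_spec a

theorem MCB.map_blockOvr_blk (M : MCB Λ G) (x : Σ l, G l) (l : Λ) (X : List (G l)) :
    (blk l X).map (M.blockOvr x)
      = blk (M.prop.hom_ovr l x).choose (X.map (M.prop.hom_ovr l x).choose_spec.choose) := by
  cases X with
  | nil => simp
  | cons a X => rw [blk_cons, List.map_cons, List.map_cons, blk_cons]; rfl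

theorem MCB.map_blockUnd_blk (M : MCB Λ G) (x : Σ l, G l) (l : Λ) (X : List (G l)) :
    (blk l X).map (M.blockUnd x)
      = blk (M.prop.hom_und l x).choose (X.map (M.prop.hom_und l x).choose_spec.choose) := by
  cases X with
  | nil => simp
  | cons a X => rw [blk_cons, List.map_cons, List.map_cons, blk_cons]; rfl

theorem blk_map_congr {l m m' : Λ} (f : G l → G m) (f' : G l → G m')
    (h : ∀ a, (⟨m, f a⟩ : Σ l, G l) = ⟨m', f' a⟩) (X : List (G l)) :
    blk m (X.map f) = blk m' (X.map f') := by
  obtain rfl : m = m' := congrArg Sigma.fst (h 1)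
  have : f = f' := funext fun a => by simpa using h a
  rw [this]

theorem MCB.blockTilde_cons (M : MCB Λ G) (l : Λ) (x : G l) (X : List (G l)) :
    M.blockTilde (.cons l x X)
      = blk (M.prop.hom_ovr l ⟨l, x⟩).choose
          (X.map fun z => (M.prop.hom_ovr l ⟨l, x⟩).choose_spec.choose (x⁻¹ * z)) := by
  cases X with
  | nil => simp [MCB.blockTilde, MCBBlock.cons]
  | cons a X => rw [List.map_cons, blk_cons]; rfl

/-- The conjugation axiom in the form used for shuffles that start in the second block. -/
theorem MCB.map_blockUnd_blk_conj (M : MCB Λ G) (l : Λ) (b : G l) (X : List (G l)) :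
    (blk l X).map (M.blockUnd ⟨l, b⟩)
      = blk (M.prop.hom_ovr l ⟨l, b⟩).choose
          (X.map fun z => (M.prop.hom_ovr l ⟨l, b⟩).choose_spec.choose (b⁻¹ * (z * b))) := by
  rw [M.map_blockUnd_blk]
  refine blk_map_congr _ _ (fun z => ?_) X
  rw [← M.und_choose, ← M.ovr_choose, M.prop.conj, mul_inv_cancel_right]

section Boundary

variable {Y : Type w} {Q : Type*} [AddCommGroup Q]

/-- The value of `o` on `⟨y⟩ pre (∂ b) post`. -/
noncomputable def MCB.blockBoundary (M : MCB Λ G) (act : Y → (Σ l, G l) → Y)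
    (o : Y × List (MCBBlock Λ G) → Q) (y : Y) (pre : List (MCBBlock Λ G)) (b : MCBBlock Λ G)
    (post : List (MCBBlock Λ G)) : Q :=
  o (act y b.head, pre.map (M.blockUnd b.head) ++ M.blockTilde b ++ post.map (M.blockOvr b.head))
    + ∑ j : Fin b.len, ((-1 : ℤ) ^ ((j : ℕ) + 1)) • o (y, pre ++ b.erase j ++ post)

/-- The part of the boundary of `⟨y⟩ pre mid post` that comes from the blocks in `mid`. -/
noncomputable def MCB.boundarySum (M : MCB Λ G) (act : Y → (Σ l, G l) → Y)
    (o : Y × List (MCBBlock Λ G) → Q) (y : Y) :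
    List (MCBBlock Λ G) → List (MCBBlock Λ G) → List (MCBBlock Λ G) → Q
  | _, [], _ => 0
  | pre, b :: mid, post =>
      (-1 : ℤ) ^ (pre.map MCBBlock.len).sum • M.blockBoundary act o y pre b (mid ++ post)
        + M.boundarySum act o y (pre ++ [b]) mid post

variable (M : MCB Λ G) (act : Y → (Σ l, G l) → Y) (o : Y × List (MCBBlock Λ G) → Q) (y : Y)

theorem MCB.boundarySum_append (pre m₁ m₂ post : List (MCBBlock Λ G)) :
    M.boundarySum act o y pre (m₁ ++ m₂) post
      = M.boundarySum act o y pre m₁ (m₂ ++ post)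
        + M.boundarySum act o y (pre ++ m₁) m₂ post := by
  induction m₁ generalizing pre with
  | nil => simp [MCB.boundarySum]
  | cons b m₁ ih => simp [MCB.boundarySum, ih, add_assoc]

theorem MCB.boundarySum_eq_sum (pre mid : List (MCBBlock Λ G)) :
    M.boundarySum act o y pre mid []
      = ∑ i : Fin mid.length, (-1 : ℤ) ^ ((pre ++ mid.take i).map MCBBlock.len).sum •
          M.blockBoundary act o y (pre ++ mid.take i) (mid.get i) (mid.drop ((i : ℕ) + 1)) := by
  induction mid generalizing pre with
  | nil => simp [MCB.boundarySum]
  | cons b mid ih =>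
    rw [MCB.boundarySum, ih]
    simp [Fin.sum_univ_succ]

theorem MCB.map_dGen (φ : FreeAbelianGroup (Y × List (MCBBlock Λ G)) →+ Q)
    (L : List (MCBBlock Λ G)) :
    φ (M.dGen act (y, L))
      = M.boundarySum act (fun g => φ (FreeAbelianGroup.of g)) y [] L [] := by
  rw [M.boundarySum_eq_sum]
  simp [MCB.dGen, MCB.blockBoundary]

/-- `F` takes the same value on a pair of blocks over `G l` as on the sum of their shuffles. -/
def RespectsShuffle (l : Λ) (F : List (MCBBlock Λ G) → Q) : Prop :=
  ∀ A B : List (G l), F (blk l A ++ blk l B) = gridShuffle (fun X => F (blk l X)) 1 1 A B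

theorem RespectsShuffle.zero (l : Λ) :
    RespectsShuffle l (fun _ : List (MCBBlock Λ G) => (0 : Q)) :=
  fun A B => (gridShuffle_zero 1 1 A B).symm

theorem RespectsShuffle.add {l : Λ} {F F' : List (MCBBlock Λ G) → Q} (h : RespectsShuffle l F)
    (h' : RespectsShuffle l F') : RespectsShuffle l (fun R => F R + F' R) := by
  intro A B
  dsimp only
  rw [gridShuffle_add, h, h']

theorem RespectsShuffle.zsmul {l : Λ} {F : List (MCBBlock Λ G) → Q} (h : RespectsShuffle l F)
    (c : ℤ) : RespectsShuffle l (fun R => c • F R) := by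
  intro A B
  dsimp only
  rw [gridShuffle_zsmul, h]

theorem RespectsShuffle.sum {l : Λ} {ι : Type*} (s : Finset ι)
    {F : ι → List (MCBBlock Λ G) → Q} (h : ∀ i, RespectsShuffle l (F i)) :
    RespectsShuffle l (fun R => ∑ i ∈ s, F i R) := by
  induction s using Finset.induction_on with
  | empty => simpa using RespectsShuffle.zero l
  | insert i s hi ih => simpa [Finset.sum_insert hi] using (h i).add ih

theorem RespectsShuffle.sign {l : Λ} {F : List (MCBBlock Λ G) → Q} (h : RespectsShuffle l F)
    (pre post : List (MCBBlock Λ G)) :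
    RespectsShuffle l
      (fun R => (-1 : ℤ) ^ ((pre ++ R ++ post).map MCBBlock.len).sum • F R) := by
  intro A B
  dsimp only
  rw [h, ← gridShuffle_zsmul]
  refine gridShuffle_congr 1 1 fun X hX => ?_
  simp only [List.map_append, List.sum_append, sum_len_blk, hX]

theorem RespectsShuffle.map {l m : Λ} {F : List (MCBBlock Λ G) → Q} (h : RespectsShuffle m F)
    (f : G l →* G m) {φ : MCBBlock Λ G → MCBBlock Λ G}
    (hφ : ∀ X : List (G l), (blk l X).map φ = blk m (X.map f)) :
    RespectsShuffle l (fun R => F (R.map φ)) := by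
  intro A B
  simp only [List.map_append, hφ]
  rw [h, gridShuffle_map f f f (map_mul f) (fun X => F (blk m X)), map_one]

/-- `o` respects shuffles of adjacent blocks in every context. -/
def ShuffleInvariant (o : Y × List (MCBBlock Λ G) → Q) : Prop :=
  ∀ (y : Y) (pre post : List (MCBBlock Λ G)) (l : Λ),
    RespectsShuffle l (fun R => o (y, pre ++ R ++ post))

variable {o}

theorem MCB.respectsShuffle_blockBoundary_left (ho : ShuffleInvariant o)
    (p₀ p₁ post : List (MCBBlock Λ G)) (b : MCBBlock Λ G) (l : Λ) :
    RespectsShuffle l (fun R => M.blockBoundary act o y p₀ b (p₁ ++ R ++ post)) := by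
  refine RespectsShuffle.add ?_ (RespectsShuffle.sum _ fun j => RespectsShuffle.zsmul ?_ _)
  · simpa [← List.append_assoc] using RespectsShuffle.map
      (ho (act y b.head) (p₀.map (M.blockUnd b.head) ++ M.blockTilde b
        ++ p₁.map (M.blockOvr b.head)) (post.map (M.blockOvr b.head)) _)
      _ (M.map_blockOvr_blk b.head l)
  · simpa [← List.append_assoc] using ho y (p₀ ++ b.erase j ++ p₁) post l

theorem MCB.respectsShuffle_blockBoundary_right (ho : ShuffleInvariant o)
    (p₀ p₁ post : List (MCBBlock Λ G)) (b : MCBBlock Λ G) (l : Λ) :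
    RespectsShuffle l (fun R => M.blockBoundary act o y (p₀ ++ R ++ p₁) b post) := by
  refine RespectsShuffle.add ?_ (RespectsShuffle.sum _ fun j => RespectsShuffle.zsmul ?_ _)
  · simpa [List.append_assoc] using RespectsShuffle.map
      (ho (act y b.head) (p₀.map (M.blockUnd b.head))
        (p₁.map (M.blockUnd b.head) ++ M.blockTilde b ++ post.map (M.blockOvr b.head)) _)
      _ (M.map_blockUnd_blk b.head l)
  · simpa [List.append_assoc] using ho y p₀ (p₁ ++ b.erase j ++ post) l

theorem MCB.respectsShuffle_boundarySum_left (ho : ShuffleInvariant o)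
    (p₀ p₁ post : List (MCBBlock Λ G)) (l : Λ) :
    RespectsShuffle l (fun R => M.boundarySum act o y p₀ p₁ (R ++ post)) := by
  induction p₁ generalizing p₀ with
  | nil => exact RespectsShuffle.zero l
  | cons b p₁ ih =>
    refine RespectsShuffle.add (RespectsShuffle.zsmul ?_ _) (ih _)
    simpa using M.respectsShuffle_blockBoundary_left act y ho p₀ p₁ post b l

theorem MCB.respectsShuffle_boundarySum_right (ho : ShuffleInvariant o)
    (p₀ p₁ post : List (MCBBlock Λ G)) (l : Λ) :
    RespectsShuffle l (fun R => M.boundarySum act o y (p₀ ++ R ++ p₁) post []) := by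
  induction post generalizing p₁ with
  | nil => exact RespectsShuffle.zero l
  | cons b post ih =>
    refine RespectsShuffle.add (RespectsShuffle.sign ?_ p₀ p₁) ?_
    · exact M.respectsShuffle_blockBoundary_right act y ho p₀ p₁ _ b l
    · simpa using ih (p₁ ++ [b])

/-- The value of `o` on the first face `⟨y⟩ pre (∂̃⟨X⟩) post`. -/
noncomputable def MCB.firstFace (M : MCB Λ G) (act : Y → (Σ l, G l) → Y)
    (o : Y × List (MCBBlock Λ G) → Q) (y : Y) (pre post : List (MCBBlock Λ G)) (l : Λ) :
    List (G l) → Q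
  | [] => 0
  | x :: X =>
      o (act y ⟨l, x⟩, pre.map (M.blockUnd ⟨l, x⟩)
        ++ blk (M.prop.hom_ovr l ⟨l, x⟩).choose
          (X.map fun z => (M.prop.hom_ovr l ⟨l, x⟩).choose_spec.choose (x⁻¹ * z))
        ++ post.map (M.blockOvr ⟨l, x⟩))

theorem MCB.boundarySum_blk (pre post : List (MCBBlock Λ G)) (l : Λ) (X : List (G l)) :
    M.boundarySum act o y pre (blk l X) post
      = (-1 : ℤ) ^ (pre.map MCBBlock.len).sum •
        (M.firstFace act o y pre post l X
          + faceSum (fun Z => o (y, pre ++ blk l Z ++ post)) X) := by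
  cases X with
  | nil => simp [MCB.boundarySum, MCB.firstFace, faceSum]
  | cons x X =>
    rw [blk_cons, MCB.boundarySum, MCB.boundarySum, add_zero, MCB.blockBoundary,
      M.blockTilde_cons, faceSum_eq_sum]
    rfl

theorem MCB.gridShuffle_firstFace (ho : ShuffleInvariant o) (pre post : List (MCBBlock Λ G))
    (l : Λ) (a b : G l) (A B : List (G l)) :
    gridShuffle (M.firstFace act o y pre post l) 1 1 (a :: A) (b :: B)
      = M.firstFace act o y pre (blk l (b :: B) ++ post) l (a :: A)
        + (-1 : ℤ) ^ (A.length + 1) •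
          M.firstFace act o y (pre ++ blk l (a :: A)) post l (b :: B) := by
  rw [gridShuffle_cons_cons, mul_one, one_mul]
  simp only [MCB.firstFace, List.map_append, M.map_blockOvr_blk, M.map_blockUnd_blk_conj]
  congr 2
  · rw [gridShuffle_map (fun z => (M.prop.hom_ovr l ⟨l, a⟩).choose_spec.choose (a⁻¹ * z))
      (M.prop.hom_ovr l ⟨l, a⟩).choose_spec.choose _ (by simp [mul_assoc])
      (fun Z => o (act y ⟨l, a⟩, pre.map (M.blockUnd ⟨l, a⟩) ++ blk _ Z
        ++ post.map (M.blockOvr ⟨l, a⟩))), inv_mul_cancel, map_one, ← ho]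
    simp only [List.append_assoc]
  · rw [gridShuffle_map
      (fun z => (M.prop.hom_ovr l ⟨l, b⟩).choose_spec.choose (b⁻¹ * (z * b)))
      (fun z => (M.prop.hom_ovr l ⟨l, b⟩).choose_spec.choose (b⁻¹ * z)) _
      (by simp [mul_assoc])
      (fun Z => o (act y ⟨l, b⟩, pre.map (M.blockUnd ⟨l, b⟩) ++ blk _ Z
        ++ post.map (M.blockOvr ⟨l, b⟩))), one_mul, inv_mul_cancel, map_one, ← ho]
    simp only [List.append_assoc]

theorem MCB.boundarySum_pair (ho : ShuffleInvariant o) (pre post : List (MCBBlock Λ G)) (l : Λ)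
    (a b : G l) (A B : List (G l)) :
    M.boundarySum act o y pre (blk l (a :: A) ++ blk l (b :: B)) post
      = gridShuffle (fun X => M.boundarySum act o y pre (blk l X) post) 1 1
          (a :: A) (b :: B) := by
  have hA : (fun Z => o (y, pre ++ blk l Z ++ (blk l (b :: B) ++ post)))
      = fun Z => gridShuffle (fun X => o (y, pre ++ blk l X ++ post)) 1 1 Z (b :: B) :=
    funext fun Z => by rw [← ho]; simp
  have hB : (fun Z => o (y, pre ++ blk l (a :: A) ++ blk l Z ++ post))
      = fun Z => gridShuffle (fun X => o (y, pre ++ blk l X ++ post)) 1 1 (a :: A) Z :=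
    funext fun Z => by rw [← ho]; simp
  rw [M.boundarySum_append]
  simp only [M.boundarySum_blk, gridShuffle_zsmul, gridShuffle_add]
  rw [M.gridShuffle_firstFace act y ho, gridShuffle_faceSum, hA, hB, List.map_append,
    List.sum_append, sum_len_blk, List.length_cons, pow_add]
  module

theorem MCB.boundarySum_pair_context (ho : ShuffleInvariant o) (pre post : List (MCBBlock Λ G))
    (l : Λ) (a b : G l) (A B : List (G l)) :
    M.boundarySum act o y [] (pre ++ (blk l (a :: A) ++ blk l (b :: B)) ++ post) []
      = gridShuffle (fun X => M.boundarySum act o y [] (pre ++ blk l X ++ post) []) 1 1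
          (a :: A) (b :: B) := by
  have hsplit (R : List (MCBBlock Λ G)) :
      M.boundarySum act o y [] (pre ++ R ++ post) []
        = M.boundarySum act o y [] pre (R ++ post) + M.boundarySum act o y pre R post
          + M.boundarySum act o y (pre ++ R ++ []) post [] := by
    simp [M.boundarySum_append, add_assoc]
  simp only [hsplit, gridShuffle_add]
  exact congrArg₂ (· + ·)
    (congrArg₂ (· + ·) (M.respectsShuffle_boundarySum_left act y ho [] pre post l _ _)
      (M.boundarySum_pair act y ho pre post l a b A B))
    (M.respectsShuffle_boundarySum_right act y ho pre [] post l _ _)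

end Boundary

theorem mkGen_of_ne_nil {Λ : Type u} {G : Λ → Type v} {Y : Type w} (y : Y)
    (pre post : List (MCBBlock Λ G)) (l : Λ) {X : List (G l)}
    (hX : X ≠ []) :
    mkGen y pre post l X = FreeAbelianGroup.of (y, pre ++ blk l X ++ post) := by
  simp [mkGen, blk, hX]
  rfl

theorem degenSet_eq (Y : Type w) :
    degenSet Y Λ G = { c | ∃ (y : Y) (pre post : List (MCBBlock Λ G)) (l : Λ) (a b : G l)
      (A B : List (G l)),
      c = FreeAbelianGroup.of (y, pre ++ (blk l (a :: A) ++ blk l (b :: B)) ++ post)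
        - gridShuffle (fun X => FreeAbelianGroup.of (y, pre ++ blk l X ++ post)) 1 1
            (a :: A) (b :: B) } := by
  have hsh (y : Y) (pre post : List (MCBBlock Λ G)) (l : Λ) (a b : G l) (A B : List (G l)) :
      gridShuffle (mkGen y pre post l) 1 1 (a :: A) (b :: B)
        = gridShuffle (fun X => FreeAbelianGroup.of (y, pre ++ blk l X ++ post)) 1 1
            (a :: A) (b :: B) :=
    gridShuffle_congr 1 1 fun X hX =>
      mkGen_of_ne_nil y pre post l (List.ne_nil_of_length_pos (by simp at hX; omega))
  ext c
  constructor
  · rintro ⟨y, pre, post, l, s, t, hs, ht, a, b, rfl⟩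
    obtain ⟨s, rfl⟩ := Nat.exists_eq_succ_of_ne_zero hs.ne'
    obtain ⟨t, rfl⟩ := Nat.exists_eq_succ_of_ne_zero ht.ne'
    refine ⟨y, pre, post, l, a 0, b 0, List.ofFn fun i => a i.succ,
      List.ofFn fun i => b i.succ, ?_⟩
    rw [← hsh, shuffleChain_eq_gridShuffle, ← List.ofFn_succ, ← List.ofFn_succ]
    simp [blk]
    rfl
  · rintro ⟨y, pre, post, l, a, b, A, B, rfl⟩
    refine ⟨y, pre, post, l, (a :: A).length, (b :: B).length, by simp, by simp,
      (a :: A).get, (b :: B).get, ?_⟩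
    rw [← hsh, shuffleChain_eq_gridShuffle]
    simp only [List.ofFn_get]
    simp [blk]
    rfl

/-- In the quotient by the degenerate subgroup, a pair of blocks agrees with its shuffles. -/
theorem shuffleInvariant_mk (Y : Type w) :
    ShuffleInvariant fun g : Y × List (MCBBlock Λ G) =>
      QuotientAddGroup.mk' (AddSubgroup.closure (degenSet Y Λ G)) (FreeAbelianGroup.of g) := by
  intro y pre post l A B
  dsimp only
  cases A with
  | nil => simp
  | cons a A =>
    cases B with
    | nil => simp
    | cons b B =>
      rw [← map_gridShuffle, ← sub_eq_zero, ← map_sub, QuotientAddGroup.mk'_apply,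
        QuotientAddGroup.eq_zero_iff]
      refine AddSubgroup.subset_closure ?_
      rw [degenSet_eq]
      exact ⟨y, pre, post, l, a, b, A, B, rfl⟩

/-- STATEMENT 14 -/
theorem stmt14 (M : MCB Λ G) {Y : Type w} [Nonempty Y] (act : Y → (Σ l, G l) → Y)
    (hact : IsMCBAction G M.und M.ovr act) :
    ∀ c ∈ AddSubgroup.closure (degenSet Y Λ G),
      M.boundary act c ∈ AddSubgroup.closure (degenSet Y Λ G) := by
  suffices AddSubgroup.closure (degenSet Y Λ G)
      ≤ (AddSubgroup.closure (degenSet Y Λ G)).comap (M.boundary act) from this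
  rw [AddSubgroup.closure_le]
  intro c hc
  rw [degenSet_eq] at hc
  obtain ⟨y, pre, post, l, a, b, A, B, rfl⟩ := hc
  rw [SetLike.mem_coe, AddSubgroup.mem_comap, ← QuotientAddGroup.eq_zero_iff,
    ← QuotientAddGroup.mk'_apply, map_sub, map_sub, map_gridShuffle, map_gridShuffle, sub_eq_zero]
  simp only [MCB.boundary, FreeAbelianGroup.lift_apply_of, M.map_dGen]
  exact M.boundarySum_pair_context act y (shuffleInvariant_mk Y) pre post l a b A B
end

section
/- Let G be a group, φ : G → Z(G) a group homomorphism into the center of G, R a ring, X a right R[G]-module with the G-family of Alexander biquandles, and X×G its associated multiple conjugation biquandle. Then X is an (X×G)-set via y*(x,g) = y⊲^g x = yg + x(φ(g)−g). Let A be an abelian group and f : X³ → A a G-invariant ℤ-multilinear map. Define Φ_f : P₂(X×G)_X → A on generators by Φ_f(⟨x⟩⟨(x₁,g₁)⟩⟨(x₂,g₂)⟩) = f((x−x₁)(1−φ(g₁)⁻¹g₁), x₁−x₂, x₂(1−φ(g₂)g₂⁻¹)) and Φ_f(⟨x⟩⟨(x₁,g₁),(x₂,g₂)⟩) = 0. Then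 Φ_f is a 2-cocycle of the multiple conjugation biquandle X×G with X-set X and coefficients in A: Φ_f vanishes on D₂(X×G)_X and Φ_f(∂₃c) = 0 for all c ∈ P₃(X×G)_X. -/
section Alexander

variable {G : Type v} [Group G] (R : Type w) [Ring R]
  {X : Type u} [AddCommGroup X] [Module (MonoidAlgebra R G)ᵐᵒᵖ X]

/-- The right action `x · r` of the group ring `R[G]` on the right module `X`. -/
noncomputable def rsmul (x : X) (r : MonoidAlgebra R G) : X := MulOpposite.op r • x

/-- The cochain `Φ_f` (trivial `X`-set case) on generators of `P_*(X×G)`,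
obtained from `λ : G → A` and a `G`-invariant `ℤ`-bilinear `f : X² → A`;
it is zero on all generators other than `⟨(x₁,g₁)⟩⟨(x₂,g₂)⟩`. -/
noncomputable def phiF2 {A : Type z} [CommRing A] (φ : G →* G) (lam : G →* A)
    (f : X → X → A) (g : PUnit × List (MCBBlock X (fun _ => G))) : A :=
  match g.2 with
  | [b₁, b₂] =>
    match b₁.2.1, b₂.2.1 with
    | [g₁], [g₂] =>
        lam g₁ * f (b₁.1 - b₂.1)
          (rsmul R b₂.1 ((1 : MonoidAlgebra R G) - MonoidAlgebra.of R G (φ g₂ * g₂⁻¹)))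
    | _, _ => 0
  | _ => 0


/-- The cochain `Φ_f` (`X`-set `X×G` itself, acting by `⊲`) on generators of
`P_*(X×G)_{X×G}`, obtained from `λ : G → A` and a `G`-invariant `ℤ`-trilinear
`f : X³ → A`. -/
noncomputable def phiF3 {A : Type z} [CommRing A] (φ : G →* G) (lam : G →* A)
    (f : X → X → X → A) (g : (Σ _ : X, G) × List (MCBBlock X (fun _ => G))) : A :=
  match g.2 with
  | [b₁, b₂] =>
    match b₁.2.1, b₂.2.1 with
    | [g₁], [g₂] =>
        lam g.1.2 * f
          (rsmul R (g.1.1 - b₁.1)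
            ((1 : MonoidAlgebra R G) - MonoidAlgebra.of R G ((φ g₁)⁻¹ * g₁)))
          (b₁.1 - b₂.1)
          (rsmul R b₂.1 ((1 : MonoidAlgebra R G) - MonoidAlgebra.of R G (φ g₂ * g₂⁻¹)))
    | _, _ => 0
  | _ => 0


/-- The cochain `Φ_f` (`X`-set the module `X` itself) on generators of
`P_*(X×G)_X`, obtained from a `G`-invariant `ℤ`-trilinear `f : X³ → A`. -/
noncomputable def phiF3' {A : Type z} [CommRing A] (φ : G →* G)
    (f : X → X → X → A) (g : X × List (MCBBlock X (fun _ => G))) : A :=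
  match g.2 with
  | [b₁, b₂] =>
    match b₁.2.1, b₂.2.1 with
    | [g₁], [g₂] =>
        f (rsmul R (g.1 - b₁.1)
            ((1 : MonoidAlgebra R G) - MonoidAlgebra.of R G ((φ g₁)⁻¹ * g₁)))
          (b₁.1 - b₂.1)
          (rsmul R b₂.1 ((1 : MonoidAlgebra R G) - MonoidAlgebra.of R G (φ g₂ * g₂⁻¹)))
    | _, _ => 0
  | _ => 0

theorem rsmul_add_left (x y : X) (r : MonoidAlgebra R G) :
    rsmul R (x + y) r = rsmul R x r + rsmul R y r := smul_add _ _ _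

theorem rsmul_sub_left (x y : X) (r : MonoidAlgebra R G) :
    rsmul R (x - y) r = rsmul R x r - rsmul R y r := smul_sub _ _ _

theorem rsmul_sub_right (x : X) (r s : MonoidAlgebra R G) :
    rsmul R x (r - s) = rsmul R x r - rsmul R x s := by
  simp only [rsmul, MulOpposite.op_sub, sub_smul]

theorem rsmul_rsmul (x : X) (r s : MonoidAlgebra R G) :
    rsmul R (rsmul R x r) s = rsmul R x (r * s) := by
  simp only [rsmul, MulOpposite.op_mul, mul_smul]

theorem rsmul_one_right (x : X) : rsmul R x (1 : MonoidAlgebra R G) = x := by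
  simp only [rsmul, MulOpposite.op_one, one_smul]

/-- The right action of a group element on the right module `X`. -/
noncomputable def gact (x : X) (g : G) : X := rsmul R x (MonoidAlgebra.of R G g)

theorem gact_add (x y : X) (g : G) : gact R (x + y) g = gact R x g + gact R y g :=
  rsmul_add_left R x y _

theorem gact_sub (x y : X) (g : G) : gact R (x - y) g = gact R x g - gact R y g :=
  rsmul_sub_left R x y _

theorem gact_gact (x : X) (g h : G) : gact R (gact R x g) h = gact R x (g * h) := by
  simp only [gact, rsmul_rsmul, map_mul]

theorem gact_one (x : X) : gact R x (1 : G) = x := by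
  simp only [gact, map_one, rsmul_one_right]

theorem rsmul_of_sub_of (x : X) (g h : G) :
    rsmul R x (MonoidAlgebra.of R G g - MonoidAlgebra.of R G h) = gact R x g - gact R x h :=
  rsmul_sub_right R x _ _

theorem rsmul_one_sub_of (x : X) (g : G) :
    rsmul R x (1 - MonoidAlgebra.of R G g) = x - gact R x g := by
  rw [rsmul_sub_right, rsmul_one_right, gact]

/-- The endomorphism `g ↦ φ(g)⁻¹ g` of `G`, for `φ` with central values. -/
def centralTwist (φ : G →* G) (hφ : ∀ g, φ g ∈ Subgroup.center G) : G →* G where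
  toFun g := (φ g)⁻¹ * g
  map_one' := by simp
  map_mul' g h := by
    have hc : g * (φ h)⁻¹ = (φ h)⁻¹ * g :=
      Subgroup.mem_center_iff.mp (inv_mem (hφ h)) g
    rw [map_mul, mul_inv_rev, mul_assoc (φ g)⁻¹ g, ← mul_assoc g, hc]
    have hc' := Subgroup.mem_center_iff.mp (hφ h) (φ g)
    simp only [← mul_assoc, ← mul_inv_rev, hc']

section Twist

variable (φ : G →* G) (hφ : ∀ g, φ g ∈ Subgroup.center G)

theorem centralTwist_mul_map (g : G) : centralTwist φ hφ g * φ g = g := by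
  have hc := Subgroup.mem_center_iff.mp (hφ g) g
  simp [centralTwist, mul_assoc, hc]

theorem map_mul_inv_eq_centralTwist_inv (g : G) : φ g * g⁻¹ = (centralTwist φ hφ g)⁻¹ := by
  have hc : g⁻¹ * φ g = φ g * g⁻¹ := Subgroup.mem_center_iff.mp (hφ g) g⁻¹
  simp [centralTwist, hc]

/-- The trilinear expression `f((y − x₁)(1 − p₁), x₁ − x₂, x₂(1 − p₂⁻¹))`. -/
noncomputable def trilinearVal {A : Type z} (f : X → X → X → A)
    (y x₁ : X) (p₁ : G) (x₂ : X) (p₂ : G) : A :=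
  f (y - x₁ - gact R (y - x₁) p₁) (x₁ - x₂) (x₂ - gact R x₂ p₂⁻¹)

/-- The Alexander quandle operation `y p + x(1 − p)`. -/
noncomputable def alexOp (y x : X) (p : G) : X := gact R y p + (x - gact R x p)

theorem alexander_und_eq (y x : X) (g : G) :
    rsmul R y (MonoidAlgebra.of R G g)
        + rsmul R x (MonoidAlgebra.of R G (φ g) - MonoidAlgebra.of R G g)
      = gact R (alexOp R y x (centralTwist φ hφ g)) (φ g) := by
  rw [rsmul_of_sub_of, alexOp, gact_add, gact_sub, gact_gact, gact_gact,
    centralTwist_mul_map]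
  rfl

theorem phiF3'_pair {A : Type z} [CommRing A] (f : X → X → X → A) (y : X)
    (b₁ b₂ : MCBBlock X (fun _ => G)) (g₁ g₂ : G) (h₁ : b₁.2.1 = [g₁]) (h₂ : b₂.2.1 = [g₂]) :
    phiF3' R φ f (y, [b₁, b₂])
      = trilinearVal R f y b₁.1 (centralTwist φ hφ g₁) b₂.1 (centralTwist φ hφ g₂) := by
  simp only [phiF3', h₁, h₂, rsmul_one_sub_of, trilinearVal,
    map_mul_inv_eq_centralTwist_inv φ hφ]
  rfl

end Twist

theorem phiF3'_eq_zero {A : Type z} [CommRing A] (φ : G →* G) (f : X → X → X → A) (y : X)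
    (L : List (MCBBlock X (fun _ => G))) (hL : L.map MCBBlock.len ≠ [1, 1]) :
    phiF3' R φ f (y, L) = 0 := by
  unfold phiF3'
  split
  · rename_i b₁ b₂ h
    split
    · rename_i g₁ g₂ h₁ h₂
      obtain rfl : L = [b₁, b₂] := h
      exact absurd (by simp [MCBBlock.len, h₁, h₂]) hL
    · rfl
  · rfl

section Cocycle

variable {A : Type z} [CommRing A] {f : X → X → X → A}

omit [CommRing A] in
theorem trilinearVal_gact
    (hfinv : ∀ (x y z : X) (g : G), f (gact R x g) (gact R y g) (gact R z g) = f x y z)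
    (c : G) (hc : c ∈ Subgroup.center G) (y x₁ : X) (p₁ : G) (x₂ : X) (p₂ : G) :
    trilinearVal R f (gact R y c) (gact R x₁ c) p₁ (gact R x₂ c) p₂
      = trilinearVal R f y x₁ p₁ x₂ p₂ := by
  have h := Subgroup.mem_center_iff.mp hc
  unfold trilinearVal
  rw [← hfinv (y - x₁ - gact R (y - x₁) p₁) (x₁ - x₂) (x₂ - gact R x₂ p₂⁻¹) c]
  simp only [gact_sub, gact_gact, h]

theorem trilinearVal_cocycle
    (hf1 : ∀ x x' y z : X, f (x + x') y z = f x y z + f x' y z)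
    (hf2 : ∀ x y y' z : X, f x (y + y') z = f x y z + f x y' z)
    (hf3 : ∀ x y z z' : X, f x y (z + z') = f x y z + f x y z')
    (hfinv : ∀ (x y z : X) (g : G), f (gact R x g) (gact R y g) (gact R z g) = f x y z)
    (y x₁ x₂ x₃ : X) (p₁ p₂ p₃ : G) :
    trilinearVal R f (alexOp R y x₁ p₁) x₂ p₂ x₃ p₃ - trilinearVal R f y x₂ p₂ x₃ p₃
      - (trilinearVal R f (alexOp R y x₂ p₂) (alexOp R x₁ x₂ p₂) (p₂⁻¹ * p₁ * p₂) x₃ p₃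
          - trilinearVal R f y x₁ p₁ x₃ p₃)
      + (trilinearVal R f (alexOp R y x₃ p₃) (alexOp R x₁ x₃ p₃) (p₃⁻¹ * p₁ * p₃)
            (alexOp R x₂ x₃ p₃) (p₃⁻¹ * p₂ * p₃)
          - trilinearVal R f y x₁ p₁ x₂ p₂) = 0 := by
  set u := y - x₁ - gact R (y - x₁) p₁ with hu
  set v := x₃ - gact R x₃ p₃⁻¹ with hv
  have s1 : ∀ a b c d, f (a - b) c d = f a c d - f b c d := fun a b c d =>
    map_sub (AddMonoidHom.mk' (fun t => f t c d) fun a b => hf1 a b c d) a b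
  have s3 : ∀ a b c d, f a b (c - d) = f a b c - f a b d := fun a b c d =>
    map_sub (AddMonoidHom.mk' (fun t => f a b t) fun c d => hf3 a b c d) c d
  have e1 : trilinearVal R f (alexOp R y x₁ p₁) x₂ p₂ x₃ p₃
      = trilinearVal R f y x₂ p₂ x₃ p₃ - (f u (x₂ - x₃) v - f (gact R u p₂) (x₂ - x₃) v) := by
    simp only [trilinearVal, ← hv, ← s1]
    congr 1
    simp only [alexOp, hu, gact_add, gact_sub]
    abel
  have e2 : trilinearVal R f (alexOp R y x₂ p₂) (alexOp R x₁ x₂ p₂) (p₂⁻¹ * p₁ * p₂) x₃ p₃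
      = f (gact R u p₂) (gact R (x₁ - x₂) p₂) v + f (gact R u p₂) (x₂ - x₃) v := by
    rw [← hf2, trilinearVal]
    congr 1
    · simp only [alexOp, hu, gact_add, gact_sub, gact_gact, mul_assoc, mul_inv_cancel_left]
      abel
    · simp only [alexOp, gact_sub]
      abel
  have e3 : trilinearVal R f (alexOp R y x₃ p₃) (alexOp R x₁ x₃ p₃) (p₃⁻¹ * p₁ * p₃)
        (alexOp R x₂ x₃ p₃) (p₃⁻¹ * p₂ * p₃)
      = trilinearVal R f y x₁ p₁ x₂ p₂ - (f u (x₁ - x₂) v - f u (x₁ - x₂) (gact R v p₂⁻¹)) := by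
    simp only [trilinearVal, ← hu, ← s3]
    rw [← hfinv u _ _ p₃]
    congr 1
    · simp only [alexOp, hu, gact_add, gact_sub, gact_gact, mul_assoc, mul_inv_cancel_left]
      abel
    · simp only [alexOp, gact_sub]
      abel
    · simp only [alexOp, hv, gact_add, gact_sub, gact_gact, mul_assoc, mul_inv_cancel_left,
        mul_inv_rev, inv_inv, inv_mul_cancel, gact_one]
      abel
  have e4 : f (gact R u p₂) (gact R (x₁ - x₂) p₂) v = f u (x₁ - x₂) (gact R v p₂⁻¹) := by
    rw [← hfinv u _ _ p₂, gact_gact, inv_mul_cancel, gact_one]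
  have e5 : trilinearVal R f y x₁ p₁ x₃ p₃ = f u (x₁ - x₂) v + f u (x₂ - x₃) v := by
    rw [← hf2, sub_add_sub_cancel, trilinearVal]
  rw [e1, e2, e3, e4, e5]
  abel

theorem trilinearVal_mul_left
    (hf1 : ∀ x x' y z : X, f (x + x') y z = f x y z + f x' y z)
    (y x₁ x₂ : X) (p₁ q₁ p₂ : G) :
    trilinearVal R f (alexOp R y x₁ p₁) x₁ (p₁⁻¹ * q₁) x₂ p₂
      = trilinearVal R f y x₁ q₁ x₂ p₂ - trilinearVal R f y x₁ p₁ x₂ p₂ := by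
  rw [eq_sub_iff_add_eq]
  simp only [trilinearVal, ← hf1]
  congr 1
  simp only [alexOp, gact_add, gact_sub, gact_gact, mul_inv_cancel_left]
  abel

theorem trilinearVal_mul_right
    (hf3 : ∀ x y z z' : X, f x y (z + z') = f x y z + f x y z')
    (hfinv : ∀ (x y z : X) (g : G), f (gact R x g) (gact R y g) (gact R z g) = f x y z)
    (y x₁ x₂ : X) (p₁ p₂ q₂ : G) :
    trilinearVal R f (alexOp R y x₂ p₂) (alexOp R x₁ x₂ p₂) (p₂⁻¹ * p₁ * p₂) x₂ (p₂⁻¹ * q₂)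
      = trilinearVal R f y x₁ p₁ x₂ q₂ - trilinearVal R f y x₁ p₁ x₂ p₂ := by
  rw [eq_sub_iff_add_eq]
  simp only [trilinearVal]
  rw [← hfinv _ (x₁ - x₂) (x₂ - gact R x₂ p₂⁻¹) p₂, ← hfinv _ (x₁ - x₂) (x₂ - gact R x₂ q₂⁻¹) p₂]
  have a1 : alexOp R y x₂ p₂ - alexOp R x₁ x₂ p₂
        - gact R (alexOp R y x₂ p₂ - alexOp R x₁ x₂ p₂) (p₂⁻¹ * p₁ * p₂)
      = gact R (y - x₁ - gact R (y - x₁) p₁) p₂ := by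
    simp only [alexOp, gact_add, gact_sub, gact_gact, mul_assoc, mul_inv_cancel_left]
    abel
  have a2 : alexOp R x₁ x₂ p₂ - x₂ = gact R (x₁ - x₂) p₂ := by
    simp only [alexOp, gact_sub]
    abel
  rw [a1, a2, ← hf3]
  congr 1
  simp only [gact_sub, gact_gact, mul_inv_rev, inv_inv, inv_mul_cancel, gact_one]
  abel

end Cocycle

section Blocks

/-- The block `⟨(x, g)⟩`. -/
def MCBBlock.single (x : X) (g : G) : MCBBlock X (fun _ => G) :=
  ⟨x, ⟨[g], List.cons_ne_nil _ _⟩⟩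

/-- The block `⟨(x, g), (x, h)⟩`. -/
def MCBBlock.double (x : X) (g h : G) : MCBBlock X (fun _ => G) :=
  ⟨x, ⟨[g, h], List.cons_ne_nil _ _⟩⟩

variable {φ : G →* G} {M : MCB X (fun _ => G)}

theorem MCB.blockOvr_fst
    (hovr : ∀ p q : Σ _ : X, G, M.ovr p q = ⟨gact R p.1 (φ q.2), p.2⟩)
    (a : Σ _ : X, G) (b : MCBBlock X (fun _ => G)) :
    (M.blockOvr a b).1 = gact R b.1 (φ a.2) := by
  have h := (M.prop.hom_ovr b.1 a).choose_spec.choose_spec 1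
  exact (congrArg Sigma.fst ((hovr _ _).symm.trans h)).symm

theorem MCB.blockOvr_snd
    (hovr : ∀ p q : Σ _ : X, G, M.ovr p q = ⟨gact R p.1 (φ q.2), p.2⟩)
    (a : Σ _ : X, G) (b : MCBBlock X (fun _ => G)) :
    (M.blockOvr a b).2.1 = b.2.1 := by
  have h := (M.prop.hom_ovr b.1 a).choose_spec.choose_spec
  exact (List.map_congr_left fun g _ =>
    (eq_of_heq (Sigma.mk.inj ((hovr _ _).symm.trans (h g))).2).symm).trans (List.map_id _)

theorem MCB.blockUnd_fst
    (hund : ∀ p q : Σ _ : X, G,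
      M.und p q = ⟨gact R (alexOp R p.1 q.1 ((φ q.2)⁻¹ * q.2)) (φ q.2), q.2⁻¹ * p.2 * q.2⟩)
    (a : Σ _ : X, G) (b : MCBBlock X (fun _ => G)) :
    (M.blockUnd a b).1 = gact R (alexOp R b.1 a.1 ((φ a.2)⁻¹ * a.2)) (φ a.2) := by
  have h := (M.prop.hom_und b.1 a).choose_spec.choose_spec 1
  exact (congrArg Sigma.fst ((hund _ _).symm.trans h)).symm

theorem MCB.blockUnd_snd
    (hund : ∀ p q : Σ _ : X, G,
      M.und p q = ⟨gact R (alexOp R p.1 q.1 ((φ q.2)⁻¹ * q.2)) (φ q.2), q.2⁻¹ * p.2 * q.2⟩)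
    (a : Σ _ : X, G) (b : MCBBlock X (fun _ => G)) :
    (M.blockUnd a b).2.1 = b.2.1.map fun g => a.2⁻¹ * g * a.2 := by
  have h := (M.prop.hom_und b.1 a).choose_spec.choose_spec
  exact List.map_congr_left fun g _ =>
    (eq_of_heq (Sigma.mk.inj ((hund _ _).symm.trans (h g))).2).symm

theorem MCB.blockTilde_double
    (hovr : ∀ p q : Σ _ : X, G, M.ovr p q = ⟨gact R p.1 (φ q.2), p.2⟩)
    (x : X) (g h : G) :
    M.blockTilde (MCBBlock.double x g h) = [MCBBlock.single (gact R x (φ g)) (g⁻¹ * h)] := by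
  have h' := (M.prop.hom_ovr x ⟨x, g⟩).choose_spec.choose_spec
  have h1 := (Sigma.mk.inj ((hovr _ _).symm.trans (h' 1))).1
  have h2 : ∀ a, a = (M.prop.hom_ovr x ⟨x, g⟩).choose_spec.choose a :=
    fun a => eq_of_heq (Sigma.mk.inj ((hovr _ _).symm.trans (h' a))).2
  refine (dif_neg (List.cons_ne_nil _ _)).trans ?_
  congr 1
  refine Sigma.ext h1.symm (heq_of_eq (Subtype.ext ?_))
  exact congrArg (fun t => [t]) (h2 (g⁻¹ * h)).symm

end Blocks

section Boundary

variable {A : Type z} [CommRing A] {φ : G →* G} {M : MCB X (fun _ => G)}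

omit [Group G] [AddCommGroup X] in
theorem MCBBlock.len_pos (b : MCBBlock X (fun _ => G)) : 0 < b.len :=
  List.length_pos_of_ne_nil b.2.2

omit [AddCommGroup X] in
theorem MCB.len_blockOvr (a : Σ _ : X, G) (b : MCBBlock X (fun _ => G)) :
    (M.blockOvr a b).len = b.len := by
  simp [MCB.blockOvr, MCBBlock.len]

omit [AddCommGroup X] in
theorem MCB.len_blockUnd (a : Σ _ : X, G) (b : MCBBlock X (fun _ => G)) :
    (M.blockUnd a b).len = b.len := by
  simp [MCB.blockUnd, MCBBlock.len]

/-- The block sizes left from one block of size `n` after removing an entry. -/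
def shrinkSize (n : ℕ) : List ℕ := if n ≤ 1 then [] else [n - 1]

omit [AddCommGroup X] in
theorem MCB.map_len_blockTilde (b : MCBBlock X (fun _ => G)) :
    (M.blockTilde b).map MCBBlock.len = shrinkSize b.len := by
  obtain ⟨x, xs, hxs⟩ := b
  rcases xs with _ | ⟨g, _ | ⟨h, t⟩⟩
  · exact absurd rfl hxs
  · simp [MCB.blockTilde, MCBBlock.len, shrinkSize]
  · refine (congrArg _ (dif_neg (List.cons_ne_nil _ _))).trans ?_
    refine congrArg (fun n => [n]) ?_
    exact (List.length_map _).trans (by simp [MCBBlock.len])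

omit [Group G] [AddCommGroup X] in
theorem MCBBlock.map_len_erase (b : MCBBlock X (fun _ => G)) (j : ℕ) (hj : j < b.len) :
    (b.erase j).map MCBBlock.len = shrinkSize b.len := by
  have hl : (b.2.1.eraseIdx j).length = b.len - 1 := List.length_eraseIdx_of_lt hj
  unfold MCBBlock.erase shrinkSize
  by_cases h : b.2.1.eraseIdx j = []
  · rw [h, List.length_nil] at hl
    rw [dif_pos h, if_pos (by omega), List.map_nil]
  · have := List.length_pos_of_ne_nil h
    rw [dif_neg h, if_neg (by omega), ← hl]
    rfl

theorem eq_of_append_shrinkSize_append_eq {p q : List ℕ} {n : ℕ} (hn : 0 < n)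
    (h : p ++ shrinkSize n ++ q = [1, 1]) :
    p ++ n :: q = [1, 1, 1] ∨ p ++ n :: q = [1, 2] ∨ p ++ n :: q = [2, 1] := by
  unfold shrinkSize at h
  have hlen := congrArg List.length h
  rcases p with _ | ⟨p₁, _ | ⟨p₂, _ | ⟨p₃, p⟩⟩⟩ <;>
    rcases q with _ | ⟨q₁, _ | ⟨q₂, _ | ⟨q₃, q⟩⟩⟩ <;>
    split_ifs at h hlen <;> simp_all <;> omega

omit [AddCommGroup X] in
theorem lift_dGen {Y : Type*} (act : Y → (Σ _ : X, G) → Y)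
    (F : Y × List (MCBBlock X (fun _ => G)) → A) (y : Y) (L : List (MCBBlock X (fun _ => G))) :
    FreeAbelianGroup.lift F (M.dGen act (y, L))
      = ∑ i : Fin L.length, ((-1 : ℤ) ^ ((L.take (i : ℕ)).map MCBBlock.len).sum) •
          (F (act y (L.get i).head,
              (L.take (i : ℕ)).map (M.blockUnd (L.get i).head) ++ M.blockTilde (L.get i)
                ++ (L.drop ((i : ℕ) + 1)).map (M.blockOvr (L.get i).head))
            + ∑ j ∈ Finset.range (L.get i).len, ((-1 : ℤ) ^ (j + 1)) •
                F (y, L.take (i : ℕ) ++ (L.get i).erase j ++ L.drop ((i : ℕ) + 1))) := by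
  simp only [MCB.dGen, map_sum, map_zsmul, map_add, FreeAbelianGroup.lift_apply_of,
    Finset.sum_range]

omit [AddCommGroup X] in
theorem lift_dGen_pair {Y : Type*} (act : Y → (Σ _ : X, G) → Y)
    (F : Y × List (MCBBlock X (fun _ => G)) → A) (y : Y) (b₁ b₂ : MCBBlock X (fun _ => G)) :
    FreeAbelianGroup.lift F (M.dGen act (y, [b₁, b₂]))
      = F (act y b₁.head, M.blockTilde b₁ ++ [M.blockOvr b₁.head b₂])
        + ∑ j ∈ Finset.range b₁.len, (-1) ^ (j + 1) * F (y, b₁.erase j ++ [b₂])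
        + (-1) ^ b₁.len * (F (act y b₂.head, M.blockUnd b₂.head b₁ :: M.blockTilde b₂)
          + ∑ j ∈ Finset.range b₂.len, (-1) ^ (j + 1) * F (y, b₁ :: b₂.erase j)) := by
  rw [lift_dGen]
  refine (Fin.sum_univ_two _).trans ?_
  simp [mul_add]

omit [AddCommGroup X] in
theorem lift_dGen_triple {Y : Type*} (act : Y → (Σ _ : X, G) → Y)
    (F : Y × List (MCBBlock X (fun _ => G)) → A) (y : Y)
    (b₁ b₂ b₃ : MCBBlock X (fun _ => G)) :
    FreeAbelianGroup.lift F (M.dGen act (y, [b₁, b₂, b₃]))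
      = F (act y b₁.head,
            M.blockTilde b₁ ++ [M.blockOvr b₁.head b₂, M.blockOvr b₁.head b₃])
        + ∑ j ∈ Finset.range b₁.len, (-1) ^ (j + 1) * F (y, b₁.erase j ++ [b₂, b₃])
        + (-1) ^ b₁.len *
          (F (act y b₂.head,
              M.blockUnd b₂.head b₁ :: (M.blockTilde b₂ ++ [M.blockOvr b₂.head b₃]))
            + ∑ j ∈ Finset.range b₂.len, (-1) ^ (j + 1) * F (y, b₁ :: (b₂.erase j ++ [b₃])))
        + (-1) ^ (b₁.len + b₂.len) *
          (F (act y b₃.head,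
              M.blockUnd b₃.head b₁ :: M.blockUnd b₃.head b₂ :: M.blockTilde b₃)
            + ∑ j ∈ Finset.range b₃.len, (-1) ^ (j + 1) * F (y, b₁ :: b₂ :: b₃.erase j)) := by
  rw [lift_dGen]
  refine (Fin.sum_univ_three _).trans ?_
  simp [mul_add]

theorem lift_phiF3'_dGen_eq_zero (f : X → X → X → A) (act : X → (Σ _ : X, G) → X) (y : X)
    (L : List (MCBBlock X (fun _ => G)))
    (hL : ¬(L.map MCBBlock.len = [1, 1, 1] ∨ L.map MCBBlock.len = [1, 2] ∨
      L.map MCBBlock.len = [2, 1])) :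
    FreeAbelianGroup.lift (phiF3' R φ f) (M.dGen act (y, L)) = 0 := by
  have key : ∀ i : Fin L.length, (L.take (i : ℕ)).map MCBBlock.len ++ shrinkSize (L.get i).len
      ++ (L.drop ((i : ℕ) + 1)).map MCBBlock.len ≠ [1, 1] := by
    intro i hi
    refine hL ?_
    have hsplit : L.map MCBBlock.len = (L.take (i : ℕ)).map MCBBlock.len
        ++ (L.get i).len :: (L.drop ((i : ℕ) + 1)).map MCBBlock.len := by
      rw [← List.map_cons, ← List.map_append]
      congr 1
      simp
    rw [hsplit]
    exact eq_of_append_shrinkSize_append_eq (L.get i).len_pos hi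
  rw [lift_dGen]
  refine Finset.sum_eq_zero fun i _ => ?_
  rw [phiF3'_eq_zero, Finset.sum_eq_zero, add_zero, smul_zero]
  · intro j hj
    rw [phiF3'_eq_zero, smul_zero]
    rw [List.map_append, List.map_append,
      MCBBlock.map_len_erase _ _ (Finset.mem_range.mp hj)]
    exact key i
  · simp only [List.map_append, List.map_map, MCB.map_len_blockTilde, Function.comp_def,
      MCB.len_blockOvr, MCB.len_blockUnd]
    exact key i

omit [Group G] [AddCommGroup X] in
theorem MCBBlock.exists_of_len_eq_one {b : MCBBlock X (fun _ => G)} (h : b.len = 1) :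
    ∃ x g, b = MCBBlock.single x g := by
  obtain ⟨x, xs, hxs⟩ := b
  obtain ⟨g, h'⟩ := List.length_eq_one_iff.mp h
  exact ⟨x, g, Sigma.ext rfl (heq_of_eq (Subtype.ext h'))⟩

omit [Group G] [AddCommGroup X] in
theorem MCBBlock.exists_of_len_eq_two {b : MCBBlock X (fun _ => G)} (h : b.len = 2) :
    ∃ x g h, b = MCBBlock.double x g h := by
  obtain ⟨x, xs, hxs⟩ := b
  obtain ⟨g, g', h'⟩ := List.length_eq_two.mp h
  exact ⟨x, g, g', Sigma.ext rfl (heq_of_eq (Subtype.ext h'))⟩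

theorem lift_phiF3'_dGen (hφ : ∀ g, φ g ∈ Subgroup.center G)
    (hund : ∀ p q : Σ _ : X, G,
      M.und p q = ⟨gact R (alexOp R p.1 q.1 (centralTwist φ hφ q.2)) (φ q.2),
        q.2⁻¹ * p.2 * q.2⟩)
    (hovr : ∀ p q : Σ _ : X, G, M.ovr p q = ⟨gact R p.1 (φ q.2), p.2⟩)
    (f : X → X → X → A)
    (hf1 : ∀ x x' y z : X, f (x + x') y z = f x y z + f x' y z)
    (hf2 : ∀ x y y' z : X, f x (y + y') z = f x y z + f x y' z)
    (hf3 : ∀ x y z z' : X, f x y (z + z') = f x y z + f x y z')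
    (hfinv : ∀ (x y z : X) (g : G), f (gact R x g) (gact R y g) (gact R z g) = f x y z)
    (y : X) (L : List (MCBBlock X (fun _ => G))) :
    FreeAbelianGroup.lift (phiF3' R φ f)
      (M.dGen (fun y p => gact R (alexOp R y p.1 (centralTwist φ hφ p.2)) (φ p.2)) (y, L))
        = 0 := by
  by_cases hL : L.map MCBBlock.len = [1, 1, 1] ∨ L.map MCBBlock.len = [1, 2] ∨
      L.map MCBBlock.len = [2, 1]
  swap
  · exact lift_phiF3'_dGen_eq_zero R f _ y L hL
  have hinv := fun c => trilinearVal_gact R hfinv (φ c) (hφ c)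
  have ovr1 : ∀ a x (g : G), M.blockOvr a (MCBBlock.single x g)
      = MCBBlock.single (gact R x (φ a.2)) g := fun a x g =>
    Sigma.ext (MCB.blockOvr_fst R hovr a _)
      (heq_of_eq (Subtype.ext (MCB.blockOvr_snd R hovr a _)))
  have und1 : ∀ a x (g : G), M.blockUnd a (MCBBlock.single x g)
      = MCBBlock.single (gact R (alexOp R x a.1 (centralTwist φ hφ a.2)) (φ a.2))
          (a.2⁻¹ * g * a.2) := fun a x g =>
    Sigma.ext (MCB.blockUnd_fst R hund a _)
      (heq_of_eq (Subtype.ext (MCB.blockUnd_snd R hund a _)))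
  have tilde1 : ∀ x (g : G), M.blockTilde (MCBBlock.single x g) = [] :=
    fun x g => dif_pos rfl
  have tilde2 := MCB.blockTilde_double (M := M) R hovr
  have erase1 : ∀ (x : X) (g : G), (MCBBlock.single x g).erase 0 = [] :=
    fun x g => dif_pos rfl
  have erase2 : ∀ (x : X) (g h : G),
      (MCBBlock.double x g h).erase 0 = [MCBBlock.single x h] :=
    fun x g h => dif_neg (List.cons_ne_nil _ _)
  have erase2' : ∀ (x : X) (g h : G),
      (MCBBlock.double x g h).erase 1 = [MCBBlock.single x g] :=
    fun x g h => dif_neg (List.cons_ne_nil _ _)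
  have len1 : ∀ (x : X) (g : G), (MCBBlock.single x g).len = 1 := fun _ _ => rfl
  have len2 : ∀ (x : X) (g h : G), (MCBBlock.double x g h).len = 2 := fun _ _ _ => rfl
  have head1 : ∀ (x : X) (g : G), (MCBBlock.single x g).head = ⟨x, g⟩ := fun _ _ => rfl
  have head2 : ∀ (x : X) (g h : G), (MCBBlock.double x g h).head = ⟨x, g⟩ :=
    fun _ _ _ => rfl
  have pair : ∀ y x₁ x₂ (g₁ g₂ : G),
      phiF3' R φ f (y, [MCBBlock.single x₁ g₁, MCBBlock.single x₂ g₂])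
        = trilinearVal R f y x₁ (centralTwist φ hφ g₁) x₂ (centralTwist φ hφ g₂) :=
    fun y x₁ x₂ g₁ g₂ => phiF3'_pair R φ hφ f y _ _ g₁ g₂ rfl rfl
  have single : ∀ y b, phiF3' R φ f (y, [b]) = 0 := fun y b =>
    phiF3'_eq_zero R φ f y _ (by simp)
  rcases hL with hL | hL | hL
  · obtain ⟨b₁, b₂, b₃, rfl⟩ := List.length_eq_three.mp (by simpa using congrArg List.length hL)
    simp only [List.map_cons, List.map_nil, List.cons.injEq, and_true] at hL
    obtain ⟨x₁, g₁, rfl⟩ := MCBBlock.exists_of_len_eq_one hL.1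
    obtain ⟨x₂, g₂, rfl⟩ := MCBBlock.exists_of_len_eq_one hL.2.1
    obtain ⟨x₃, g₃, rfl⟩ := MCBBlock.exists_of_len_eq_one hL.2.2
    have := trilinearVal_cocycle R hf1 hf2 hf3 hfinv y x₁ x₂ x₃ (centralTwist φ hφ g₁)
      (centralTwist φ hφ g₂) (centralTwist φ hφ g₃)
    rw [lift_dGen_triple]
    simp [len1, head1, erase1, ovr1, und1, tilde1, pair, hinv]
    linear_combination this
  · obtain ⟨b₁, b₂, rfl⟩ := List.length_eq_two.mp (by simpa using congrArg List.length hL)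
    simp only [List.map_cons, List.map_nil, List.cons.injEq, and_true] at hL
    obtain ⟨x₁, g₁, rfl⟩ := MCBBlock.exists_of_len_eq_one hL.1
    obtain ⟨x₂, g₂, h₂, rfl⟩ := MCBBlock.exists_of_len_eq_two hL.2
    have := trilinearVal_mul_right R hf3 hfinv y x₁ x₂ (centralTwist φ hφ g₁)
      (centralTwist φ hφ g₂) (centralTwist φ hφ h₂)
    rw [lift_dGen_pair]
    simp [len1, len2, head1, head2, erase1, erase2, erase2', und1, tilde1, tilde2, pair, hinv, single,
      Finset.sum_range_succ, this]
  · obtain ⟨b₁, b₂, rfl⟩ := List.length_eq_two.mp (by simpa using congrArg List.length hL)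
    simp only [List.map_cons, List.map_nil, List.cons.injEq, and_true] at hL
    obtain ⟨x₁, g₁, h₁, rfl⟩ := MCBBlock.exists_of_len_eq_two hL.1
    obtain ⟨x₂, g₂, rfl⟩ := MCBBlock.exists_of_len_eq_one hL.2
    have := trilinearVal_mul_left R hf1 y x₁ x₂ (centralTwist φ hφ g₁)
      (centralTwist φ hφ h₁) (centralTwist φ hφ g₂)
    rw [lift_dGen_pair]
    simp [len1, len2, head1, head2, erase1, erase2, erase2', ovr1, tilde1, tilde2, pair, hinv, single,
      Finset.sum_range_succ, this]

end Boundary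

section Degenerate

variable {A : Type z} [CommRing A]

theorem lift_phiF3'_degenSet (φ : G →* G) (f : X → X → X → A)
    (hf2 : ∀ x y y' z : X, f x (y + y') z = f x y z + f x y' z)
    {c : FreeAbelianGroup (X × List (MCBBlock X (fun _ => G)))}
    (hc : c ∈ degenSet X X (fun _ => G)) :
    FreeAbelianGroup.lift (phiF3' R φ f) c = 0 := by
  obtain ⟨y, pre, post, l, s, t, hs, ht, a, b, rfl⟩ := hc
  have hf0 : ∀ x z, f x 0 z = 0 := fun x z =>
    (AddMonoidHom.mk' (fun y => f x y z) fun y y' => hf2 x y y' z).map_zero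
  have hfirst : ∀ b₁ b₂ : MCBBlock X (fun _ => G), b₁.1 = b₂.1 →
      phiF3' R φ f (y, pre ++ b₁ :: b₂ :: post) = 0 := by
    intro b₁ b₂ h
    unfold phiF3'
    split
    · rename_i c₁ c₂ hL
      have hlen := congrArg List.length hL
      simp only [List.length_append, List.length_cons, List.length_nil] at hlen
      obtain rfl := List.length_eq_zero_iff.mp (show pre.length = 0 by omega)
      obtain rfl := List.length_eq_zero_iff.mp (show post.length = 0 by omega)
      simp only [List.nil_append, List.cons.injEq, and_true] at hL
      obtain ⟨rfl, rfl⟩ := hL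
      split
      · rw [h, sub_self, hf0]
      · rfl
    · rfl
  have hshuffle : ∀ μ : Fin s → Fin (s + t), FreeAbelianGroup.lift (phiF3' R φ f)
      (mkGen y pre post l (shuffleEntries (G := fun _ : X => G) (l := l) a b μ)) = 0 := by
    intro μ
    unfold mkGen
    split_ifs with h
    · exact map_zero _
    · rw [FreeAbelianGroup.lift_apply_of]
      refine phiF3'_eq_zero R φ f y _ fun hL => ?_
      have hmem : s + t ∈ [1, 1] := by
        rw [← hL]
        exact List.mem_map.mpr
          ⟨_, List.mem_append_right _ List.mem_cons_self, List.length_ofFn⟩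
      simp only [List.mem_cons, List.not_mem_nil, or_false, or_self] at hmem
      omega
  rw [map_sub, FreeAbelianGroup.lift_apply_of]
  refine (congrArg₂ (· - ·) (hfirst _ _ ?_) ?_).trans (sub_zero 0)
  · rfl
  rw [shuffleChain, map_sum]
  refine Finset.sum_eq_zero fun μ _ => ?_
  split_ifs
  · rw [map_zsmul, hshuffle, smul_zero]
  · exact map_zero _

end Degenerate

theorem alexander_isMCBAction {φ : G →* G} (hφ : ∀ g, φ g ∈ Subgroup.center G)
    {M : MCB X (fun _ => G)}
    (hund : ∀ p q : Σ _ : X, G,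
      M.und p q = ⟨gact R (alexOp R p.1 q.1 (centralTwist φ hφ q.2)) (φ q.2),
        q.2⁻¹ * p.2 * q.2⟩) :
    IsMCBAction (fun _ : X => G) M.und M.ovr
      (fun (y : X) (p : Σ _ : X, G) =>
        gact R (alexOp R y p.1 (centralTwist φ hφ p.2)) (φ p.2)) where
  act_one y l := by simp [alexOp, gact_one]
  act_mul y l a b := by
    simpa only [hund] using congrArg Sigma.fst (M.prop.und_mul l a b ⟨y, 1⟩)
  act_ex y a b := by
    simpa only [hund] using (congrArg Sigma.fst (M.prop.ex_uu ⟨y, 1⟩ b a)).symm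

/-- STATEMENT 19 -/
theorem stmt19 {A : Type z} [CommRing A]
    (φ : G →* G) (hφ : ∀ g, φ g ∈ Subgroup.center G)
    (M : MCB X (fun _ => G))
    (hund : ∀ p q : Σ _ : X, G,
      M.und p q = ⟨rsmul R p.1 (MonoidAlgebra.of R G q.2)
          + rsmul R q.1 (MonoidAlgebra.of R G (φ q.2) - MonoidAlgebra.of R G q.2),
        q.2⁻¹ * p.2 * q.2⟩)
    (hovr : ∀ p q : Σ _ : X, G,
      M.ovr p q = ⟨rsmul R p.1 (MonoidAlgebra.of R G (φ q.2)), p.2⟩)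
    (f : X → X → X → A)
    (hf1 : ∀ x x' y z : X, f (x + x') y z = f x y z + f x' y z)
    (hf2 : ∀ x y y' z : X, f x (y + y') z = f x y z + f x y' z)
    (hf3 : ∀ x y z z' : X, f x y (z + z') = f x y z + f x y z')
    (hfinv : ∀ (x y z : X) (g : G),
      f (rsmul R x (MonoidAlgebra.of R G g)) (rsmul R y (MonoidAlgebra.of R G g))
        (rsmul R z (MonoidAlgebra.of R G g)) = f x y z) :
    IsMCBAction (fun _ : X => G) M.und M.ovr
      (fun (y : X) (p : Σ _ : X, G) =>
        rsmul R y (MonoidAlgebra.of R G p.2)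
          + rsmul R p.1 (MonoidAlgebra.of R G (φ p.2) - MonoidAlgebra.of R G p.2)) ∧
    (∀ c ∈ AddSubgroup.closure (degenSet X X (fun _ => G)),
        FreeAbelianGroup.lift (phiF3' R φ f) c = 0) ∧
    (∀ c : FreeAbelianGroup (X × List (MCBBlock X (fun _ => G))),
        FreeAbelianGroup.lift (phiF3' R φ f)
          (M.boundary (fun (y : X) (p : Σ _ : X, G) =>
            rsmul R y (MonoidAlgebra.of R G p.2)
              + rsmul R p.1 (MonoidAlgebra.of R G (φ p.2) - MonoidAlgebra.of R G p.2)) c)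
          = 0) := by
  have hact := alexander_und_eq R φ hφ (X := X)
  simp only [hact] at hund ⊢
  refine ⟨alexander_isMCBAction R hφ hund, fun c hc => ?_, fun c => ?_⟩
  · induction hc using AddSubgroup.closure_induction with
    | mem c hc => exact lift_phiF3'_degenSet R φ f hf2 hc
    | zero => exact map_zero _
    | add c d _ _ hc hd => rw [map_add, hc, hd, add_zero]
    | neg c _ hc => rw [map_neg, hc, neg_zero]
  · induction c using FreeAbelianGroup.induction_on with
    | zero => rw [map_zero, map_zero]
    | of g =>
      rw [MCB.boundary, FreeAbelianGroup.lift_apply_of]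
      exact lift_phiF3'_dGen R hφ hund hovr f hf1 hf2 hf3 hfinv g.1 g.2
    | neg g hg => rw [map_neg, map_neg, hg, neg_zero]
    | add c d hc hd => rw [map_add, map_add, hc, hd, add_zero]

end Alexander
end
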